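/- arXiv:2504.18456 — 2 statements merged into one kernel-verified Lean document; each statement's English description precedes it below -/
import Mathlib

section
/- Let g : ℝ^d → ℝ be continuous with compact support and g ≥ 0. Then for every ε > 0 there exists a smooth function h : ℝ^d → ℝ with compact support such that sup_{x ∈ ℝ^d} |h(x)² − g(x)| ≤ ε. In other words, every nonnegative continuous compactly supported function is a uniform limit of squares of smooth compactly supported functions. -/
theorem stmt5 (d : ℕ) (hd : 1 ≤ d)
    (g : EuclideanSpace ℝ (Fin d) → ℝ) (hg : Continuous g)
    (hsupp : HasCompactSupport g) (hpos : ∀ x, 0 ≤ g x) :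
    ∀ ε > (0 : ℝ), ∃ h : EuclideanSpace ℝ (Fin d) → ℝ,
      ContDiff ℝ (⊤ : ℕ∞) h ∧ HasCompactSupport h ∧
      ∀ x, |h x ^ 2 - g x| ≤ ε := by
  intro ε hε
  have hden : ∀ x, 0 < 2 * √(g x) + 1 + ε := fun x => by positivity
  -- Approximate `√g` with a pointwise tolerance `δ` chosen so that `δ * (2 * √g + δ) ≤ ε`.
  obtain ⟨h, h_smooth, h_approx, h_supp⟩ :=
    (Real.continuous_sqrt.comp hg).exists_contDiff_approx ⊤
      (ε := fun x => ε / (2 * √(g x) + 1 + ε))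
      (continuous_const.div (by fun_prop) fun x => (hden x).ne')
      (fun x => div_pos hε (hden x))
  refine ⟨h, h_smooth, ?_, fun x => ?_⟩
  · exact hsupp.mono (h_supp.trans fun x hx hgx => hx (by simp [hgx]))
  · have hs : 0 ≤ √(g x) := Real.sqrt_nonneg _
    have hlt : |h x - √(g x)| < ε / (2 * √(g x) + 1 + ε) := by
      simpa [Real.dist_eq] using h_approx x
    have hmul : |h x - √(g x)| * (2 * √(g x) + 1 + ε) < ε := (lt_div_iff₀ (hden x)).1 hlt
    have hle_one : |h x - √(g x)| ≤ 1 :=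
      hlt.le.trans ((div_le_one (hden x)).2 (by linarith))
    have hsum : |h x + √(g x)| ≤ 2 * √(g x) + 1 + ε := by
      rw [abs_le] at hle_one ⊢
      constructor <;> linarith
    calc |h x ^ 2 - g x| = |h x - √(g x)| * |h x + √(g x)| := by
          rw [← abs_mul]
          congr 1
          linear_combination Real.sq_sqrt (hpos x)
      _ ≤ |h x - √(g x)| * (2 * √(g x) + 1 + ε) := by gcongr
      _ ≤ ε := hmul.le
end

section
/- Let H be a complex Hilbert space and let K_u, K_w : H → H be bounded positive linear operators which commute: K_u ∘ K_w = K_w ∘ K_u. Then there exists a bounded linear operator F : H → H such that: (1) F is positive; (2) the identity minus F is positive (so 0 ≤ F ≤ I, and in particular ‖F‖ ≤ 1); (3) F commutes with K_u and with K_w; and (4) K_u = F ∘ (K_u + K_w). -/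
open ContinuousLinearMap
open scoped ComplexOrder

section Helpers

variable {H : Type*} [NormedAddCommGroup H] [InnerProductSpace ℂ H]

theorem isPositive_of_inner_nonneg {T : H →L[ℂ] H} (h : ∀ x, 0 ≤ inner ℂ (T x) x) :
    T.IsPositive := by
  rw [isPositive_iff_complex]
  intro x
  obtain ⟨hre, him⟩ := Complex.nonneg_iff.mp (h x)
  exact ⟨Complex.ext (by simp) (by simpa using him), hre⟩

variable [CompleteSpace H]

/-- Products of commuting positive operators are positive, in inner product form. -/
theorem inner_apply_apply_nonneg_of_commute {A B : H →L[ℂ] H} (hA : A.IsPositive)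
    (hB : B.IsPositive) (hAB : Commute A B) (x : H) : 0 ≤ inner ℂ (A x) (B x) := by
  have hBA : (B * A).IsPositive := (nonneg_iff_isPositive _).mp <|
    hAB.symm.mul_nonneg ((nonneg_iff_isPositive _).mpr hB) ((nonneg_iff_isPositive _).mpr hA)
  have h := hBA.inner_nonneg_left x
  rwa [mul_def, comp_apply, hB.inner_left_eq_inner_right] at h

theorem norm_apply_le_norm_add_apply_of_commute {A B : H →L[ℂ] H} (hA : A.IsPositive)
    (hB : B.IsPositive) (hAB : Commute A B) (x : H) : ‖A x‖ ≤ ‖(A + B) x‖ := by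
  have hre : 0 ≤ RCLike.re (inner ℂ (A x) (B x)) :=
    (Complex.nonneg_iff.mp (inner_apply_apply_nonneg_of_commute hA hB hAB x)).1
  have hsq := norm_add_sq (𝕜 := ℂ) (A x) (B x)
  rw [add_apply]
  exact le_of_sq_le_sq (by nlinarith [sq_nonneg ‖B x‖]) (norm_nonneg _)

/-- The sum map from the domain and the kernel of a self-adjoint operator has dense range. -/
theorem IsSelfAdjoint.denseRange_coprod_ker {S : H →L[ℂ] H} (hS : IsSelfAdjoint S) :
    DenseRange ((S : H →ₗ[ℂ] H).coprod S.ker.subtype) := by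
  have hd : Dense (((S : H →ₗ[ℂ] H).coprod S.ker.subtype).range : Set H) := by
    rw [Submodule.dense_iff_topologicalClosure_eq_top, Submodule.topologicalClosure_eq_top_iff,
      LinearMap.range_coprod, Submodule.range_subtype, ← Submodule.inf_orthogonal,
      ContinuousLinearMap.orthogonal_range, hS.adjoint_eq]
    exact Submodule.inf_orthogonal_eq_bot _
  rwa [LinearMap.coe_range] at hd

/-- If `A` is dominated by the self-adjoint `S`, then `A = F ∘ S` for some bounded `F` vanishing on
the kernel of `S`. -/
theorem exists_comp_eq_of_norm_apply_le {A S : H →L[ℂ] H} (hS : IsSelfAdjoint S)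
    (hAS : ∀ x, ‖A x‖ ≤ ‖S x‖) :
    ∃ F : H →L[ℂ] H, ∀ x, ∀ n, S n = 0 → F (S x + n) = A x := by
  let e : H × S.ker →ₗ[ℂ] H := (S : H →ₗ[ℂ] H).coprod S.ker.subtype
  let f : H × S.ker →ₗ[ℂ] H := (A : H →ₗ[ℂ] H) ∘ₗ LinearMap.fst ℂ H S.ker
  have hb : ∀ p, ‖f p‖ ≤ 1 * ‖e p‖ := by
    rintro ⟨x, n, hn⟩
    have hn' : S n = 0 := hn
    have horth : inner ℂ (S x) n = 0 := by
      rw [hS.isSymmetric.apply_clm x n, hn', inner_zero_right]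
    have hsq := norm_add_sq_eq_norm_sq_add_norm_sq_of_inner_eq_zero (S x) n horth
    have hle : ‖S x‖ ≤ ‖S x + n‖ :=
      le_of_sq_le_sq (by nlinarith [sq_nonneg ‖n‖]) (norm_nonneg _)
    simpa [e, f] using (hAS x).trans hle
  refine ⟨f.extendOfNorm e, fun x n hn => ?_⟩
  simpa [e, f] using LinearMap.extendOfNorm_eq (f := f) (e := e)
    hS.denseRange_coprod_ker ⟨1, hb⟩ (x, ⟨n, hn⟩)

/-- A closed property holds everywhere if it holds on sums of the range and the kernel of a
self-adjoint operator. -/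
theorem IsSelfAdjoint.induction_apply_add_ker {S : H →L[ℂ] H} (hS : IsSelfAdjoint S)
    {p : H → Prop} (hp : IsClosed {x | p x}) (h : ∀ x n, S n = 0 → p (S x + n)) (x : H) : p x :=
  hS.denseRange_coprod_ker.induction_on x hp fun ⟨y, n, hn⟩ => by simpa using h y n hn

end Helpers

theorem stmt10 {H : Type*} [NormedAddCommGroup H] [InnerProductSpace ℂ H]
    [CompleteSpace H]
    (Ku Kw : H →L[ℂ] H) (hKu : Ku.IsPositive) (hKw : Kw.IsPositive)
    (hcomm : Ku ∘L Kw = Kw ∘L Ku) :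
    ∃ F : H →L[ℂ] H,
      F.IsPositive ∧
      (1 - F).IsPositive ∧
      (F ∘L Ku = Ku ∘L F ∧ F ∘L Kw = Kw ∘L F) ∧
      Ku = F ∘L (Ku + Kw) := by
  have huw : Commute Ku Kw := hcomm
  have hSpos := hKu.add hKw
  have hS : IsSelfAdjoint (Ku + Kw) := hSpos.isSelfAdjoint
  have hle := norm_apply_le_norm_add_apply_of_commute hKu hKw huw
  obtain ⟨F, hF⟩ := exists_comp_eq_of_norm_apply_le hS hle
  have hFS : ∀ x, F ((Ku + Kw) x) = Ku x := fun x => by simpa using hF x 0 (map_zero _)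
  have hu0 : ∀ n, (Ku + Kw) n = 0 → Ku n = 0 := fun n hn => by
    simpa [hn] using hle n
  have hw0 : ∀ n, (Ku + Kw) n = 0 → Kw n = 0 := fun n hn => by
    simpa [hu0 n hn] using hn
  have hcommF : ∀ T : H →L[ℂ] H, Commute T Ku → Commute T Kw →
      (∀ n, (Ku + Kw) n = 0 → T n = 0) → F ∘L T = T ∘L F := by
    intro T hTu hTw hT0
    ext x
    refine hS.induction_apply_add_ker (p := fun x => (F ∘L T) x = (T ∘L F) x)
      (isClosed_eq (by fun_prop) (by fun_prop)) (fun y n hn => ?_) x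
    have hTS : T ((Ku + Kw) y) = (Ku + Kw) (T y) := DFunLike.congr_fun (hTu.add_right hTw).eq y
    have hTK : T (Ku y) = Ku (T y) := DFunLike.congr_fun hTu.eq y
    rw [comp_apply, comp_apply, hF y n hn, map_add, hT0 n hn, add_zero, hTS, hFS, hTK]
  refine ⟨F, isPositive_of_inner_nonneg fun x => ?_, isPositive_of_inner_nonneg fun x => ?_,
    ⟨hcommF Ku (.refl _) huw hu0, hcommF Kw huw.symm (.refl _) hw0⟩,
    ContinuousLinearMap.ext fun x => (hFS x).symm⟩
  · refine hS.induction_apply_add_ker (p := fun x => 0 ≤ inner ℂ (F x) x)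
      (isClosed_le (by fun_prop) (by fun_prop)) (fun y n hn => ?_) x
    rw [hF y n hn, inner_add_right, hKu.inner_left_eq_inner_right y n, hu0 n hn, inner_zero_right,
      add_zero]
    exact inner_apply_apply_nonneg_of_commute hKu hSpos ((Commute.refl _).add_right huw) y
  · refine hS.induction_apply_add_ker (p := fun x => 0 ≤ inner ℂ ((1 - F) x) x)
      (isClosed_le (by fun_prop) (by fun_prop)) (fun y n hn => ?_) x
    have hsub : (1 - F) ((Ku + Kw) y + n) = Kw y + n := by
      rw [sub_apply, hF y n hn, one_def, id_apply, add_apply]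
      abel
    have hnS : inner ℂ n ((Ku + Kw) y) = 0 := by
      rw [← hSpos.inner_left_eq_inner_right, hn, inner_zero_left]
    rw [hsub, inner_add_left, inner_add_right, inner_add_right,
      hKw.inner_left_eq_inner_right y n, hw0 n hn, inner_zero_right, hnS, add_zero, zero_add]
    exact add_nonneg
      (inner_apply_apply_nonneg_of_commute hKw hSpos (huw.symm.add_right (.refl _)) y)
      (isPositive_id.inner_nonneg_left n)
end
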